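/- Let M and N be finite groups and let (𝒳,𝒦) and (𝒴,𝓛) be supercharacter theories of M and N respectively. Set G = M × N, 𝓜 = {K × L : K ∈ 𝒦, L ∈ 𝓛}, and 𝒵 = {X × Y : X ∈ 𝒳, Y ∈ 𝒴}, where K × L = {(m,n) : m ∈ K, n ∈ L} ⊆ G and X × Y = {φ × θ : φ ∈ X, θ ∈ Y} ⊆ Irr(G), with φ × θ the external product character (φ×θ)(m,n) = φ(m)θ(n). Then (𝒵, 𝓜) is a supercharacter theory of G. -/

import Mathlib

open scoped Classical

noncomputable section

/-- The set of irreducible complex characters of `G`. -/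
def Irr (G : Type) [Group G] : Set (G → ℂ) :=
  {χ | ∃ V : FDRep ℂ G, CategoryTheory.Simple V ∧ FDRep.character V = χ}

/-- `σ_X = ∑_{ψ ∈ X} ψ(1)·ψ`. -/
def sigmaChar {G : Type} [Group G] (X : Set (G → ℂ)) : G → ℂ :=
  fun g => ∑ᶠ ψ ∈ X, ψ 1 * ψ g

/-- `P` is a set partition of the set `S`. -/
def IsPartitionOf {α : Type*} (S : Set α) (P : Set (Set α)) : Prop :=
  ∅ ∉ P ∧ (∀ p ∈ P, p ⊆ S) ∧ ∀ a ∈ S, ∃! p, p ∈ P ∧ a ∈ p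

/-- `(𝒳, 𝒦)` is a supercharacter theory of the finite group `G`. -/
def IsSCT (G : Type) [Group G] [Finite G]
    (𝒳 : Set (Set (G → ℂ))) (𝒦 : Set (Set G)) : Prop :=
  IsPartitionOf (Irr G) 𝒳 ∧ IsPartitionOf Set.univ 𝒦 ∧ 𝒳.ncard = 𝒦.ncard ∧
    ({1} : Set G) ∈ 𝒦 ∧
    ∀ X ∈ 𝒳, ∀ K ∈ 𝒦, ∀ g ∈ K, ∀ h ∈ K, sigmaChar X g = sigmaChar X h

/-- `K̂ = ∑_{g ∈ K} g ∈ ℂ[G]`. -/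
def ghat {G : Type} [Group G] (K : Set G) : MonoidAlgebra ℂ G :=
  ∑ᶠ g ∈ K, MonoidAlgebra.single g (1 : ℂ)

/-- The central idempotent `e_χ = (χ(1)/|G|) ∑_g conj(χ g)·g` attached to a character. -/
def eIdem (G : Type) [Group G] (χ : G → ℂ) : MonoidAlgebra ℂ G :=
  (χ 1 / (Nat.card G : ℂ)) •
    ∑ᶠ g : G, (starRingEnd ℂ) (χ g) • MonoidAlgebra.single g (1 : ℂ)

/-- `f_X = ∑_{ψ ∈ X} e_ψ`. -/
def fIdem (G : Type) [Group G] (X : Set (G → ℂ)) : MonoidAlgebra ℂ G :=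
  ∑ᶠ χ ∈ X, eIdem G χ

/-- Partition order: every part of `P` lies in some part of `Q`. -/
def PartLE {α : Type*} (P Q : Set (Set α)) : Prop := ∀ p ∈ P, ∃ q ∈ Q, p ⊆ q

/-- The join of two partitions of the same set: parts are connected components of
the relation "lying in a common part of `P` or of `Q`". -/
def PartJoin {α : Type*} (P Q : Set (Set α)) : Set (Set α) :=
  {C | ∃ a ∈ ⋃₀ P, C = {b | Relation.ReflTransGen
      (fun x y => (∃ p ∈ P, x ∈ p ∧ y ∈ p) ∨ ∃ q ∈ Q, x ∈ q ∧ y ∈ q) a b}}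

/-- Inner product of complex-valued functions on a finite group. -/
def cInner (H : Type) [Group H] (α β : H → ℂ) : ℂ :=
  (Nat.card H : ℂ)⁻¹ * ∑ᶠ h : H, α h * (starRingEnd ℂ) (β h)

/-- Restriction of a function on `G` to a subgroup. -/
def resChar {G : Type} [Group G] (H : Subgroup G) (χ : G → ℂ) : ↥H → ℂ := fun h => χ ↑h

/-- Extension by zero of a function on a subgroup. -/
def zeroExtend {G : Type} [Group G] (H : Subgroup G) (φ : ↥H → ℂ) : G → ℂ :=
  fun g => if h : g ∈ H then φ ⟨g, h⟩ else 0

/-- The induced class function `φ^G`. -/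
def indChar {G : Type} [Group G] (H : Subgroup G) (φ : ↥H → ℂ) : G → ℂ :=
  fun g => (Nat.card ↥H : ℂ)⁻¹ * ∑ᶠ x : G, zeroExtend H φ (x⁻¹ * g * x)

/-- The superclass of `x` with respect to a partition `𝒦` of `G`. -/
def sclass {G : Type} [Group G] (𝒦 : Set (Set G)) (x : G) : Set G := ⋃₀ {K ∈ 𝒦 | x ∈ K}

/-- Superinduction: `φ^{(G)}(x) = [G:H]·(1/|[x]|)·∑_{y ∈ [x]} φ⁰(y)`. -/
def superInd {G : Type} [Group G] (𝒦 : Set (Set G)) (H : Subgroup G) (φ : ↥H → ℂ) : G → ℂ :=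
  fun x => (H.index : ℂ) * (((sclass 𝒦 x).ncard : ℂ))⁻¹ * ∑ᶠ y ∈ sclass 𝒦 x, zeroExtend H φ y

/-- A subgroup is `𝒞`-normal when it is a union of superclasses. -/
def CNormal {G : Type} [Group G] (𝒦 : Set (Set G)) (N : Subgroup G) : Prop :=
  ∃ T ⊆ 𝒦, (N : Set G) = ⋃₀ T

/-- `Irr(G/N)` viewed inside `Irr(G)`: irreducible characters with `N` in their kernel. -/
def IrrOver {G : Type} [Group G] (N : Subgroup G) : Set (G → ℂ) :=
  {χ ∈ Irr G | ∀ n ∈ N, χ n = χ 1}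

/-- The set of irreducible constituents of the restriction of `θ` to `N`. -/
def constituentsOn {G : Type} [Group G] (N : Subgroup G) (θ : G → ℂ) : Set (↥N → ℂ) :=
  {ψ ∈ Irr ↥N | cInner ↥N (resChar N θ) ψ ≠ 0}

/-- `Irr(G|ψ)`: irreducible characters of `G` lying over `ψ ∈ Irr(N)`. -/
def irrOverChar {G : Type} [Group G] (N : Subgroup G) (ψ : ↥N → ℂ) : Set (G → ℂ) :=
  {χ ∈ Irr G | cInner ↥N (resChar N χ) ψ ≠ 0}

/-- `X^G = ⋃_{ψ ∈ X} Irr(G|ψ)` for `X ⊆ Irr(N)`. -/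
def indSet {G : Type} [Group G] (N : Subgroup G) (X : Set (↥N → ℂ)) : Set (G → ℂ) :=
  ⋃ ψ ∈ X, irrOverChar N ψ

/-- Conjugation of a normal subgroup by a group element. -/
def conjSub {G : Type} [Group G] {N : Subgroup G} (hN : N.Normal) (g : G) (n : ↥N) : ↥N :=
  ⟨g * ↑n * g⁻¹, hN.conj_mem ↑n n.2 g⟩

/-- The conjugation action of `g ∈ G` on class functions of a normal subgroup `N`. -/
def charConj {G : Type} [Group G] {N : Subgroup G} (hN : N.Normal) (g : G)
    (ψ : ↥N → ℂ) : ↥N → ℂ :=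
  fun n => ψ (conjSub hN g⁻¹ n)

/-- Inflation of a set of characters of `G/N` to characters of `G`. -/
def inflateSet {G : Type} [Group G] (N : Subgroup G) [N.Normal]
    (Y : Set (G ⧸ N → ℂ)) : Set (G → ℂ) :=
  (fun η => η ∘ (QuotientGroup.mk : G → G ⧸ N)) '' Y

/-- Deflation of a set of characters of `G` (with `N` in their kernels) to characters
of `G/N`. -/
def deflate {G : Type} [Group G] (N : Subgroup G) [N.Normal]
    (X : Set (G → ℂ)) : Set (G ⧸ N → ℂ) :=
  (fun χ => fun q : G ⧸ N => χ (Quotient.out q)) '' X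

/-- The natural map `M → MN/N ≤ G/N`. -/
def projMN {G : Type} [Group G] (M N : Subgroup G) [N.Normal] (m : ↥M) :
    ↥(M.map (QuotientGroup.mk' N)) :=
  ⟨QuotientGroup.mk' N ↑m, Subgroup.mem_map_of_mem _ m.2⟩

end

section ProductPartitions

variable {α β γ : Type*} {S : Set α} {T : Set β} {P : Set (Set α)} {Q : Set (Set β)}
  {f : α × β → γ}

theorem IsPartitionOf.nonempty (hP : IsPartitionOf S P) {p : Set α} (hp : p ∈ P) :
    p.Nonempty :=
  Set.nonempty_iff_ne_empty.2 fun h => hP.1 (h ▸ hp)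

theorem IsPartitionOf.eq_of_mem (hP : IsPartitionOf S P) {p q : Set α} (hp : p ∈ P) (hq : q ∈ P)
    {a : α} (hap : a ∈ p) (haq : a ∈ q) : p = q :=
  (hP.2.2 a (hP.2.1 p hp hap)).unique ⟨hp, hap⟩ ⟨hq, haq⟩

/-- The product of two partitions, transported along a map that is injective on the product of
the partitioned sets. -/
theorem IsPartitionOf.image_prod (hP : IsPartitionOf S P) (hQ : IsPartitionOf T Q)
    (hf : Set.InjOn f (S ×ˢ T)) :
    IsPartitionOf (f '' (S ×ˢ T))
      ((fun p : Set α × Set β => f '' (p.1 ×ˢ p.2)) '' (P ×ˢ Q)) := by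
  refine ⟨?_, ?_, ?_⟩
  · rintro ⟨⟨p, q⟩, ⟨hp, hq⟩, h⟩
    exact (((hP.nonempty hp).prod (hQ.nonempty hq)).image f).ne_empty h
  · rintro _ ⟨⟨p, q⟩, ⟨hp, hq⟩, rfl⟩
    exact Set.image_mono (Set.prod_mono (hP.2.1 p hp) (hQ.2.1 q hq))
  · rintro _ ⟨⟨a, b⟩, ⟨ha, hb⟩, rfl⟩
    obtain ⟨p, ⟨hp, hap⟩, -⟩ := hP.2.2 a ha
    obtain ⟨q, ⟨hq, hbq⟩, -⟩ := hQ.2.2 b hb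
    refine ⟨f '' (p ×ˢ q), ⟨⟨(p, q), ⟨hp, hq⟩, rfl⟩, ⟨(a, b), ⟨hap, hbq⟩, rfl⟩⟩, ?_⟩
    rintro _ ⟨⟨⟨p', q'⟩, ⟨hp', hq'⟩, rfl⟩, ⟨⟨a', b'⟩, ⟨ha', hb'⟩, h⟩⟩
    obtain ⟨rfl, rfl⟩ := Prod.mk.inj
      (hf ⟨hP.2.1 p' hp' ha', hQ.2.1 q' hq' hb'⟩ ⟨ha, hb⟩ h)
    have h₁ : p' = p := hP.eq_of_mem hp' hp ha' hap
    have h₂ : q' = q := hQ.eq_of_mem hq' hq hb' hbq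
    simp only [h₁, h₂]

theorem IsPartitionOf.injOn_image_prod (hP : IsPartitionOf S P) (hQ : IsPartitionOf T Q)
    (hf : Set.InjOn f (S ×ˢ T)) :
    Set.InjOn (fun p : Set α × Set β => f '' (p.1 ×ˢ p.2)) (P ×ˢ Q) := by
  rintro ⟨p, q⟩ ⟨hp, hq⟩ ⟨p', q'⟩ ⟨hp', hq'⟩ h
  obtain ⟨a, ha⟩ := hP.nonempty hp
  obtain ⟨b, hb⟩ := hQ.nonempty hq
  have hab : f (a, b) ∈ f '' (p' ×ˢ q') :=
    h.subset (Set.mem_image_of_mem f ⟨ha, hb⟩)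
  obtain ⟨⟨a', b'⟩, ⟨ha', hb'⟩, h'⟩ := hab
  obtain ⟨rfl, rfl⟩ := Prod.mk.inj
    (hf ⟨hP.2.1 p' hp' ha', hQ.2.1 q' hq' hb'⟩ ⟨hP.2.1 p hp ha, hQ.2.1 q hq hb⟩ h')
  exact Prod.ext (hP.eq_of_mem hp hp' ha ha') (hQ.eq_of_mem hq hq' hb hb')

theorem IsPartitionOf.ncard_image_prod (hP : IsPartitionOf S P) (hQ : IsPartitionOf T Q)
    (hf : Set.InjOn f (S ×ˢ T)) :
    ((fun p : Set α × Set β => f '' (p.1 ×ˢ p.2)) '' (P ×ˢ Q)).ncard = P.ncard * Q.ncard := by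
  rw [(hP.injOn_image_prod hQ hf).ncard_image, Set.ncard_prod]

end ProductPartitions

section Finsum

variable {α β R : Type*} [Semiring R] [NoZeroDivisors R]

/-- A product of two `finsum`s is the `finsum` of the products; no finiteness is needed, since the
support of the right-hand side is infinite as soon as one of the two supports is infinite and
the other one is nonempty. -/
theorem finsum_mul_finsum_eq_finsum_prod (f : α → R) (g : β → R) :
    (∑ᶠ a, f a) * ∑ᶠ b, g b = ∑ᶠ p : α × β, f p.1 * g p.2 := by
  have hsupp : (Function.support fun p : α × β => f p.1 * g p.2) =
      Function.support f ×ˢ Function.support g := by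
    ext p
    simp
  by_cases hf : (Function.support f).Finite
  · by_cases hg : (Function.support g).Finite
    · have hfin : (Function.support fun p : α × β => f p.1 * g p.2).Finite :=
        hsupp ▸ hf.prod hg
      rw [finsum_curry _ hfin, finsum_mul' _ _ hf]
      exact finsum_congr fun a => mul_finsum' _ _ hg
    · rcases (Function.support f).eq_empty_or_nonempty with h | h
      · rw [Function.support_eq_empty_iff] at h
        simp [h]
      · have hinf : (Function.support fun p : α × β => f p.1 * g p.2).Infinite :=
          hsupp ▸ Set.Infinite.prod_right hg h
        rw [finsum_of_infinite_support hg, finsum_of_infinite_support hinf, mul_zero]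
  · rcases (Function.support g).eq_empty_or_nonempty with h | h
    · rw [Function.support_eq_empty_iff] at h
      simp [h]
    · have hinf : (Function.support fun p : α × β => f p.1 * g p.2).Infinite :=
        hsupp ▸ Set.Infinite.prod_left hf h
      rw [finsum_of_infinite_support hf, finsum_of_infinite_support hinf, zero_mul]

theorem finsum_mem_mul_finsum_mem (s : Set α) (t : Set β) (f : α → R) (g : β → R) :
    (∑ᶠ a ∈ s, f a) * ∑ᶠ b ∈ t, g b = ∑ᶠ p ∈ s ×ˢ t, f p.1 * g p.2 := by
  simp only [finsum_mem_def]
  rw [finsum_mul_finsum_eq_finsum_prod]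
  refine finsum_congr fun p => ?_
  by_cases h₁ : p.1 ∈ s <;> by_cases h₂ : p.2 ∈ t <;> simp [Set.indicator, h₁, h₂]

end Finsum

section Irreducible

open Representation

variable {G : Type} [Group G]

theorem irr_apply_one_ne_zero [Finite G] {χ : G → ℂ} (hχ : χ ∈ Irr G) : χ 1 ≠ 0 := by
  obtain ⟨V, hV, rfl⟩ := hχ
  have := Fintype.ofFinite G
  intro h
  rw [FDRep.char_one, Nat.cast_eq_zero, Module.finrank_zero_iff] at h
  have hz : V.character = 0 := funext fun g => by
    have : V.ρ g = 0 := Subsingleton.elim _ _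
    simp [FDRep.character, this]
  have h1 := (FDRep.simple_iff_char_is_norm_one V).1 hV
  simp only [hz, Pi.zero_apply, mul_zero, Finset.sum_const_zero] at h1
  exact NeZero.ne _ h1.symm

theorem irr_sum_mul_inv_self [Fintype G] {χ : G → ℂ} (hχ : χ ∈ Irr G) :
    ∑ g, χ g * χ g⁻¹ = Nat.card G := by
  obtain ⟨V, hV, rfl⟩ := hχ
  exact (FDRep.simple_iff_char_is_norm_one V).1 hV

theorem irr_eq_of_sum_ne_zero [Fintype G] {χ ψ : G → ℂ} (hχ : χ ∈ Irr G) (hψ : ψ ∈ Irr G)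
    (h : ∑ g, χ g * ψ g⁻¹ ≠ 0) : χ = ψ := by
  obtain ⟨V, hV, rfl⟩ := hχ
  obtain ⟨W, hW, rfl⟩ := hψ
  have := invertibleOfNonzero (NeZero.ne (Nat.card G : ℂ))
  have ho := FDRep.char_orthonormal V W
  by_cases hi : Nonempty (V ≅ W)
  · exact FDRep.char_iso hi.some
  · rw [if_neg hi, mul_eq_zero] at ho
    exact (h (ho.resolve_left (inv_ne_zero (NeZero.ne _)))).elim

/-- Irreducible characters that are proportional are equal. -/
theorem irr_eq_of_smul_eq_smul [Finite G] {χ ψ : G → ℂ} (hχ : χ ∈ Irr G) (hψ : ψ ∈ Irr G)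
    {a b : ℂ} (ha : a ≠ 0) (h : ∀ g, a * χ g = b * ψ g) : χ = ψ := by
  have := Fintype.ofFinite G
  refine (irr_eq_of_sum_ne_zero hψ hχ fun h0 => ?_).symm
  have key : a * ∑ g, χ g * χ g⁻¹ = b * ∑ g, ψ g * χ g⁻¹ := by
    simp only [Finset.mul_sum, ← mul_assoc, h]
  rw [irr_sum_mul_inv_self hχ, h0, mul_zero] at key
  exact mul_ne_zero ha (NeZero.ne _) key

theorem character_mem_irr [Finite G] {V : Type} [AddCommGroup V] [Module ℂ V]
    [FiniteDimensional ℂ V] (ρ : Representation ℂ G V) [IsIrreducible ρ] : ρ.character ∈ Irr G := by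
  have := Fintype.ofFinite G
  have := invertibleOfNonzero (NeZero.ne (Nat.card G : ℂ))
  refine ⟨FDRep.of ρ, (FDRep.simple_iff_char_is_norm_one _).2 ?_, rfl⟩
  have h := char_orthonormal ρ ρ
  rw [if_pos ⟨Representation.Equiv.refl ρ⟩, inv_mul_eq_one₀ (NeZero.ne _)] at h
  exact h.symm

end Irreducible

section IrreducibleSubrepresentation

open Representation

variable {G k V : Type*} [Group G] [Field k] [AddCommGroup V] [Module k V]
  {ρ : Representation k G V}

/-- A subrepresentation of a subrepresentation, as a subrepresentation. -/
def Subrepresentation.mapSubtype (τ : Subrepresentation ρ)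
    (υ : Subrepresentation τ.toRepresentation) : Subrepresentation ρ where
  toSubmodule := υ.toSubmodule.map τ.toSubmodule.subtype
  apply_mem_toSubmodule g := by
    rintro _ ⟨v, hv, rfl⟩
    exact ⟨τ.toRepresentation g v, υ.apply_mem_toSubmodule g hv, rfl⟩

theorem Subrepresentation.isIrreducible_of_isAtom {τ : Subrepresentation ρ} (hτ : IsAtom τ) :
    IsIrreducible τ.toRepresentation := by
  have hbot : τ.toSubmodule ≠ ⊥ := fun h => hτ.1 (Subrepresentation.toSubmodule_injective h)
  have : Nontrivial τ.toSubmodule := Submodule.nontrivial_iff_ne_bot.2 hbot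
  have : Nontrivial (Subrepresentation τ.toRepresentation) :=
    ⟨⊥, ⊤, fun h => bot_ne_top (α := Submodule k τ.toSubmodule)
      (congrArg Subrepresentation.toSubmodule h)⟩
  refine ⟨fun υ => ?_⟩
  have hle : τ.mapSubtype υ ≤ τ := Submodule.map_subtype_le τ.toSubmodule υ.toSubmodule
  rcases hτ.le_iff.1 hle with h | h
  · left
    apply Subrepresentation.toSubmodule_injective
    have h' : υ.toSubmodule.map τ.toSubmodule.subtype = ⊥ :=
      congrArg Subrepresentation.toSubmodule h
    apply Submodule.map_injective_of_injective (Submodule.subtype_injective τ.toSubmodule)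
    exact h'.trans (Submodule.map_bot _).symm
  · right
    apply Subrepresentation.toSubmodule_injective
    have h' : υ.toSubmodule.map τ.toSubmodule.subtype = τ.toSubmodule :=
      congrArg Subrepresentation.toSubmodule h
    apply Submodule.map_injective_of_injective (Submodule.subtype_injective τ.toSubmodule)
    exact h'.trans (Submodule.map_subtype_top _).symm

/-- A nonzero representation of a finite group in good characteristic has an irreducible
subrepresentation. -/
theorem Representation.exists_isAtom [Finite G] [NeZero (Nat.card G : k)] [Nontrivial V]
    (ρ : Representation k G V) : ∃ τ : Subrepresentation ρ, IsAtom τ := by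
  have : Nontrivial ρ.asModule := ‹Nontrivial V›
  obtain ⟨s, hs⟩ := IsAtomic.exists_atom (Submodule (MonoidAlgebra k G) ρ.asModule)
  exact ⟨Subrepresentation.subrepresentationSubmoduleOrderIso.symm s,
    (OrderIso.isAtom_iff _ _).2 hs⟩

end IrreducibleSubrepresentation

section ExternalProduct

open Representation TensorProduct

variable {M N : Type} [Group M] [Group N]

/-- The external product of representations of `M` and `N`. -/
noncomputable def Representation.externalTensor {k V W : Type*} [Field k] [AddCommGroup V] [Module k V]
    [AddCommGroup W] [Module k W] (ρ : Representation k M V) (σ : Representation k N W) :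
    Representation k (M × N) (V ⊗[k] W) :=
  tprod (ρ.comp (MonoidHom.fst M N)) (σ.comp (MonoidHom.snd M N))

theorem Representation.character_externalTensor {k V W : Type*} [Field k] [AddCommGroup V]
    [Module k V] [FiniteDimensional k V] [AddCommGroup W] [Module k W] [FiniteDimensional k W]
    (ρ : Representation k M V) (σ : Representation k N W) (g : M × N) :
    (externalTensor ρ σ).character g = ρ.character g.1 * σ.character g.2 :=
  congrFun (char_tensor (ρ.comp (MonoidHom.fst M N)) (σ.comp (MonoidHom.snd M N))) g

variable [Finite M] [Finite N]

theorem irr_mul_mem_irr_prod {φ : M → ℂ} {θ : N → ℂ} (hφ : φ ∈ Irr M) (hθ : θ ∈ Irr N) :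
    (fun g : M × N => φ g.1 * θ g.2) ∈ Irr (M × N) := by
  have := Fintype.ofFinite M
  have := Fintype.ofFinite N
  have h₁ := irr_sum_mul_inv_self hφ
  have h₂ := irr_sum_mul_inv_self hθ
  obtain ⟨V, hV, rfl⟩ := hφ
  obtain ⟨W, hW, rfl⟩ := hθ
  have hchar : (FDRep.of (externalTensor V.ρ W.ρ)).character =
      fun g : M × N => V.character g.1 * W.character g.2 :=
    funext fun g => character_externalTensor V.ρ W.ρ g
  refine ⟨FDRep.of (externalTensor V.ρ W.ρ), ?_, hchar⟩
  rw [FDRep.simple_iff_char_is_norm_one, hchar, Nat.card_prod, Nat.cast_mul, ← h₁, ← h₂,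
    Finset.sum_mul_sum, Fintype.sum_prod_type]
  refine Finset.sum_congr rfl fun m _ => Finset.sum_congr rfl fun n _ => ?_
  simp only [Prod.fst_inv, Prod.snd_inv]
  ring

theorem injOn_irr_mul :
    Set.InjOn (fun q : (M → ℂ) × (N → ℂ) => fun g : M × N => q.1 g.1 * q.2 g.2)
      (Irr M ×ˢ Irr N) := by
  rintro ⟨φ, θ⟩ ⟨hφ, hθ⟩ ⟨φ', θ'⟩ ⟨hφ', hθ'⟩ h
  have h' (m : M) (n : N) : φ m * θ n = φ' m * θ' n := congrFun h (m, n)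
  refine Prod.ext (irr_eq_of_smul_eq_smul hφ hφ' (irr_apply_one_ne_zero hθ) (b := θ' 1) ?_)
    (irr_eq_of_smul_eq_smul hθ hθ' (irr_apply_one_ne_zero hφ) (b := φ' 1) (h' 1))
  intro m
  rw [mul_comm, h', mul_comm]

/-- The action of `N` on the space of `M`-equivariant maps from a representation of `M` to a
representation of `M × N`. -/
def Representation.homRight {k U V : Type*} [Field k] [AddCommGroup U] [Module k U]
    [AddCommGroup V] [Module k V] (σ : Representation k M U) (ρ : Representation k (M × N) V) :
    Representation k N (IntertwiningMap σ (ρ.comp (MonoidHom.inl M N))) where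
  toFun n :=
    { toFun := fun f =>
        { toLinearMap := ρ (1, n) ∘ₗ f.toLinearMap
          isIntertwining' := fun m => by
            ext u
            have h := IntertwiningMap.isIntertwining _ _ f m u
            simp only [MonoidHom.comp_apply, MonoidHom.inl_apply] at h
            simp only [LinearMap.comp_apply, IntertwiningMap.toLinearMap_apply, h,
              MonoidHom.comp_apply, MonoidHom.inl_apply]
            simp only [← Module.End.mul_apply, ← map_mul, Prod.mk_mul_mk, one_mul, mul_one] }
      map_add' := fun f g => by ext u; simp
      map_smul' := fun c f => by ext u; simp }
  map_one' := by ext f u; simp [← Prod.one_eq_mk]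
  map_mul' n n' := by
    ext f u
    have : ((1, n * n') : M × N) = (1, n) * (1, n') := by simp
    simp only [this, map_mul]
    rfl

theorem exists_irr_mul_eq {χ : M × N → ℂ} (hχ : χ ∈ Irr (M × N)) :
    ∃ φ ∈ Irr M, ∃ θ ∈ Irr N, (fun g : M × N => φ g.1 * θ g.2) = χ := by
  have := Fintype.ofFinite M
  have := Fintype.ofFinite N
  have := invertibleOfNonzero (NeZero.ne (Nat.card (M × N) : ℂ))
  have hone := irr_apply_one_ne_zero hχ
  obtain ⟨V, hV, rfl⟩ := id hχ
  have : Nontrivial V := by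
    rw [FDRep.char_one, Nat.cast_ne_zero] at hone
    exact Module.nontrivial_of_finrank_pos (Nat.pos_of_ne_zero hone)
  let ρ : Representation ℂ (M × N) V := V.ρ
  obtain ⟨τ, hτ⟩ := Representation.exists_isAtom (ρ.comp (MonoidHom.inl M N))
  have := Subrepresentation.isIrreducible_of_isAtom hτ
  let incl : IntertwiningMap τ.toRepresentation (ρ.comp (MonoidHom.inl M N)) :=
    ⟨τ.toSubmodule.subtype, fun m => rfl⟩
  have hincl : incl ≠ 0 := fun h => hτ.1 <| Subrepresentation.toSubmodule_injective <| by
    have h' : τ.toSubmodule.subtype = 0 := congrArg IntertwiningMap.toLinearMap h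
    rw [← Submodule.range_subtype τ.toSubmodule, h', LinearMap.range_zero]
    rfl
  have : Nontrivial (IntertwiningMap τ.toRepresentation (ρ.comp (MonoidHom.inl M N))) :=
    ⟨incl, 0, hincl⟩
  have : FiniteDimensional ℂ
      (IntertwiningMap τ.toRepresentation (ρ.comp (MonoidHom.inl M N))) :=
    FiniteDimensional.of_injective (IntertwiningMap.toLinearMapl _ _)
      (IntertwiningMap.toLinearMap_injective _ _)
  obtain ⟨υ, hυ⟩ := Representation.exists_isAtom (homRight τ.toRepresentation ρ)
  have := Subrepresentation.isIrreducible_of_isAtom hυ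
  have hφ := character_mem_irr τ.toRepresentation
  have hθ := character_mem_irr υ.toRepresentation
  refine ⟨_, hφ, _, hθ, ?_⟩
  let ev : IntertwiningMap (externalTensor τ.toRepresentation υ.toRepresentation) ρ :=
    { toLinearMap := TensorProduct.lift
        ((IntertwiningMap.toLinearMapl _ _ ∘ₗ υ.toSubmodule.subtype).flip)
      isIntertwining' := by
        rintro ⟨m, n⟩
        ext u f
        have h := IntertwiningMap.isIntertwining _ _ f.1 m u
        have hmn : ((m, n) : M × N) = (1, n) * (m, 1) := by simp
        change ρ (1, n) (f.1 (τ.toRepresentation m u)) = ρ (m, n) (f.1 u)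
        rw [h, hmn, map_mul]
        rfl }
  have hev : ev ≠ 0 := by
    intro h
    obtain ⟨f, hf, hf0⟩ : ∃ f ∈ υ.toSubmodule, f ≠ 0 :=
      Submodule.exists_mem_ne_zero_of_ne_bot
        fun h => hυ.1 (Subrepresentation.toSubmodule_injective h)
    refine hf0 (IntertwiningMap.ext (LinearMap.ext fun u => ?_))
    exact DFunLike.congr_fun (congrArg IntertwiningMap.toLinearMap h) (u ⊗ₜ[ℂ] ⟨f, hf⟩)
  have hnt : Nontrivial
      (IntertwiningMap (externalTensor τ.toRepresentation υ.toRepresentation) ρ) := ⟨ev, 0, hev⟩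
  have : FiniteDimensional ℂ
      (IntertwiningMap (externalTensor τ.toRepresentation υ.toRepresentation) ρ) :=
    FiniteDimensional.of_injective (IntertwiningMap.toLinearMapl _ _)
      (IntertwiningMap.toLinearMap_injective _ _)
  have hsum := card_inv_mul_sum_char_mul_char_eq_finrank
    (externalTensor τ.toRepresentation υ.toRepresentation) ρ
  refine (irr_eq_of_sum_ne_zero hχ (irr_mul_mem_irr_prod hφ hθ) fun h0 => ?_).symm
  simp only [character_externalTensor] at hsum
  have hpos := Module.finrank_pos (R := ℂ)
    (M := IntertwiningMap (externalTensor τ.toRepresentation υ.toRepresentation) ρ)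
  refine hpos.ne' (Nat.cast_eq_zero (R := ℂ).1 ?_)
  rw [← hsum]
  exact mul_eq_zero_of_right _ h0

theorem image_irr_mul_eq_irr_prod :
    (fun q : (M → ℂ) × (N → ℂ) => fun g : M × N => q.1 g.1 * q.2 g.2) '' (Irr M ×ˢ Irr N) =
      Irr (M × N) := by
  ext χ
  constructor
  · rintro ⟨⟨φ, θ⟩, ⟨hφ, hθ⟩, rfl⟩
    exact irr_mul_mem_irr_prod hφ hθ
  · intro hχ
    obtain ⟨φ, hφ, θ, hθ, h⟩ := exists_irr_mul_eq hχ
    exact ⟨(φ, θ), ⟨hφ, hθ⟩, h⟩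

theorem sigmaChar_image_mul {X : Set (M → ℂ)} {Y : Set (N → ℂ)} (hX : X ⊆ Irr M)
    (hY : Y ⊆ Irr N) (g : M × N) :
    sigmaChar ((fun q : (M → ℂ) × (N → ℂ) =>
      fun mn : M × N => q.1 mn.1 * q.2 mn.2) '' (X ×ˢ Y)) g =
      sigmaChar X g.1 * sigmaChar Y g.2 := by
  simp only [sigmaChar]
  rw [finsum_mem_image (injOn_irr_mul.mono (Set.prod_mono hX hY)), finsum_mem_mul_finsum_mem]
  refine finsum_congr fun q => finsum_congr fun _ => ?_
  simp only [Prod.fst_one, Prod.snd_one]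
  ring

end ExternalProduct

/-- direct products. Given supercharacter theories `(𝒳,𝒦)` of `M`
and `(𝒴,𝓛)` of `N`, the pair `({X × Y}, {K × L})` is a supercharacter theory of
`M × N`, where `X × Y` consists of the external product characters `φ × θ`. -/
theorem stmt18 (M N : Type) [Group M] [Group N] [Finite M] [Finite N]
    (𝒳 : Set (Set (M → ℂ))) (𝒦 : Set (Set M))
    (𝒴 : Set (Set (N → ℂ))) (𝓛 : Set (Set N))
    (hC : IsSCT M 𝒳 𝒦) (hD : IsSCT N 𝒴 𝓛) :
    IsSCT (M × N)
      ((fun p : Set (M → ℂ) × Set (N → ℂ) =>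
          (fun q : (M → ℂ) × (N → ℂ) =>
            fun mn : M × N => q.1 mn.1 * q.2 mn.2) '' (p.1 ×ˢ p.2)) '' (𝒳 ×ˢ 𝒴))
      ((fun p : Set M × Set N => p.1 ×ˢ p.2) '' (𝒦 ×ˢ 𝓛)) := by
  obtain ⟨hX, hK, hXK, h1K, hσ⟩ := hC
  obtain ⟨hY, hL, hYL, h1L, hσ'⟩ := hD
  have hid : Set.InjOn (id : M × N → M × N) (Set.univ ×ˢ Set.univ) := Function.injective_id.injOn
  have hKL := hK.image_prod hL hid
  have hcard := hK.ncard_image_prod hL hid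
  simp only [Set.image_id, Set.univ_prod_univ] at hKL hcard
  refine ⟨?_, hKL, ?_, ?_, ?_⟩
  · rw [← image_irr_mul_eq_irr_prod]
    exact hX.image_prod hY injOn_irr_mul
  · rw [hcard, hX.ncard_image_prod hY injOn_irr_mul, hXK, hYL]
  · exact ⟨({1}, {1}), ⟨h1K, h1L⟩, Set.singleton_prod_singleton⟩
  · rintro _ ⟨⟨X, Y⟩, ⟨hXm, hYm⟩, rfl⟩ _ ⟨⟨K, L⟩, ⟨hKm, hLm⟩, rfl⟩ g ⟨hg₁, hg₂⟩ h ⟨hh₁, hh₂⟩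
    rw [sigmaChar_image_mul (hX.2.1 X hXm) (hY.2.1 Y hYm),
      sigmaChar_image_mul (hX.2.1 X hXm) (hY.2.1 Y hYm),
      hσ X hXm K hKm g.1 hg₁ h.1 hh₁, hσ' Y hYm L hLm g.2 hg₂ h.2 hh₂]
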